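/- Let h : ℝ → ℂ be a function in the class H₀. Then ∑_{n=1}^{∞} (Λ(n)²/n)·ĥ((log n)/(2π)) = ∫_{−∞}^{∞} h(t)·K(1+it) dt, where both the series and the integral converge absolutely, and for t ≠ 0, K(1+it) = ∑_{m=1}^{∞} b_m (ζ'/ζ)'(m(1+it)). -/

import Mathlib

open Complex MeasureTheory Filter Topology

/-- The Fourier transform `ĥ(ξ) = ∫ h(x) e^{-2πixξ} dx`. -/
noncomputable def FT (h : ℝ → ℂ) (ξ : ℝ) : ℂ :=
  ∫ x : ℝ, h x * Complex.exp (-(2 * Real.pi * Complex.I * x * ξ))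

/-- The class `H`: `∫ h = 0`, `∫ |x h(x)| dx < ∞`, and `|ĥ'(ξ)| ≪ |ξ|^{-5}` for `|ξ| ≥ 1`. -/
structure MemH (h : ℝ → ℂ) : Prop where
  integrable : Integrable h
  integral_zero : ∫ x : ℝ, h x = 0
  xh_integrable : Integrable (fun x : ℝ => (x : ℂ) * h x)
  ft_deriv_decay : ∃ C : ℝ, ∀ ξ : ℝ, 1 ≤ |ξ| → ‖deriv (FT h) ξ‖ ≤ C * |ξ| ^ (-5 : ℝ)

/-- The class `H₀`: members of `H` such that `0` is not in the closure of the support. -/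
structure MemH0 (h : ℝ → ℂ) extends MemH h : Prop where
  zero_not_mem : (0 : ℝ) ∉ closure (Function.support h)

/-- The radical (squarefree kernel) of a natural number: the product of its prime factors. -/
def Nat.rad (m : ℕ) : ℕ := ∏ p ∈ m.primeFactors, p

/-- `b m = μ(rad m) · φ(rad m)`. -/
noncomputable def bcoef (m : ℕ) : ℤ :=
  ArithmeticFunction.moebius m.rad * (Nat.totient m.rad : ℤ)

/-- `(ζ'/ζ)'`, the derivative of the logarithmic derivative of the Riemann zeta function. -/
noncomputable def zetaLogDerivDeriv (s : ℂ) : ℂ :=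
  deriv (fun z => deriv riemannZeta z / riemannZeta z) s

/-- The analytic continuation `K(s) = ∑_{m≥1} b_m (ζ'/ζ)'(ms)` of `∑ Λ(n)²/n^s`,
valid on the line `Re s = 1`, `s ≠ 1`. -/
noncomputable def Kcont (s : ℂ) : ℂ :=
  ∑' m : ℕ, (bcoef (m + 1) : ℂ) * zetaLogDerivDeriv ((m + 1 : ℕ) * s)

/-- `(s - 1)` times the `x`-th Euler–Maclaurin correction term
`(x + 1) ^ (-s) - ∫ u in x..x + 1, u ^ (-s)` for the zeta series. -/
noncomputable def zetaCorrection (x : ℝ) (s : ℂ) : ℂ :=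
  (s - 1) * ((x + 1 : ℝ) : ℂ) ^ (-s) + (((x + 1 : ℝ) : ℂ) ^ (1 - s) - (x : ℂ) ^ (1 - s))

lemma norm_cpow_neg_sub_cpow_neg_le {x : ℝ} (hx : 0 < x) {s : ℂ} (hs : 0 < s.re) {y : ℝ}
    (hy : y ∈ Set.Icc x (x + 1)) :
    ‖((x + 1 : ℝ) : ℂ) ^ (-s) - (y : ℂ) ^ (-s)‖ ≤ ‖s‖ * x ^ (-s.re - 1) := by
  have hs0 : s ≠ 0 := by rintro rfl; simp at hs
  have key := Convex.norm_image_sub_le_of_norm_hasDerivWithin_le (𝕜 := ℝ)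
    (f := fun u : ℝ => (u : ℂ) ^ (-s)) (f' := fun u : ℝ => -s * (u : ℂ) ^ (-s - 1))
    (s := Set.Icc x (x + 1)) (x := y) (y := x + 1) (C := ‖s‖ * x ^ (-s.re - 1))
    (fun u hu => (hasDerivAt_ofReal_cpow_const (hx.trans_le hu.1).ne'
      (neg_ne_zero.mpr hs0)).hasDerivWithinAt)
    (fun u hu => by
      have hu0 : 0 < u := hx.trans_le hu.1
      rw [norm_mul, norm_neg, Complex.norm_cpow_eq_rpow_re_of_pos hu0]
      gcongr
      simp only [Complex.sub_re, Complex.neg_re, Complex.one_re]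
      exact Real.rpow_le_rpow_of_nonpos hx hu.1 (by linarith))
    (convex_Icc _ _) hy ⟨by linarith, le_rfl⟩
  refine key.trans ?_
  have : ‖x + 1 - y‖ ≤ 1 := by
    rw [Real.norm_eq_abs, abs_le]; constructor <;> linarith [hy.1, hy.2]
  exact mul_le_of_le_one_right (by positivity) this

lemma norm_cpow_neg_sub_cpow_neg_le_two {x : ℝ} (hx : 0 < x) {s : ℂ} (hs : 0 < s.re) {y : ℝ}
    (hy : y ∈ Set.Icc x (x + 1)) :
    ‖((x + 1 : ℝ) : ℂ) ^ (-s) - (y : ℂ) ^ (-s)‖ ≤ 2 * x ^ (-s.re) := by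
  have aux : ∀ u : ℝ, x ≤ u → ‖(u : ℂ) ^ (-s)‖ ≤ x ^ (-s.re) := fun u hu => by
    rw [Complex.norm_cpow_eq_rpow_re_of_pos (hx.trans_le hu)]
    exact Real.rpow_le_rpow_of_nonpos hx hu (by simpa using hs.le)
  linarith [norm_sub_le (((x + 1 : ℝ) : ℂ) ^ (-s)) ((y : ℂ) ^ (-s)), aux (x + 1) (by linarith),
    aux y hy.1]

lemma norm_zetaCorrection_le_of_forall {x : ℝ} (hx : 0 < x) {s : ℂ} {B : ℝ}
    (hB : ∀ y ∈ Set.Icc x (x + 1), ‖((x + 1 : ℝ) : ℂ) ^ (-s) - (y : ℂ) ^ (-s)‖ ≤ B) :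
    ‖zetaCorrection x s‖ ≤ ‖s - 1‖ * B := by
  rcases eq_or_ne s 1 with rfl | hs1
  · simp [zetaCorrection]
  have hs1' : 1 - s ≠ 0 := sub_ne_zero.mpr hs1.symm
  have key := Convex.norm_image_sub_le_of_norm_hasDerivWithin_le (𝕜 := ℝ)
    (f := fun u : ℝ => (s - 1) * ((x + 1 : ℝ) : ℂ) ^ (-s) * (u : ℂ) + (u : ℂ) ^ (1 - s))
    (f' := fun u : ℝ => (s - 1) * ((x + 1 : ℝ) : ℂ) ^ (-s) * 1 + (1 - s) * (u : ℂ) ^ (1 - s - 1))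
    (s := Set.Icc x (x + 1)) (x := x) (y := x + 1) (C := ‖s - 1‖ * B)
    (fun u hu => (((Complex.ofRealCLM.hasDerivAt (x := u)).const_mul _).add
      (hasDerivAt_ofReal_cpow_const (hx.trans_le hu.1).ne' hs1')).hasDerivWithinAt)
    (fun u hu => by
      have : (s - 1) * ((x + 1 : ℝ) : ℂ) ^ (-s) * 1 + (1 - s) * (u : ℂ) ^ (1 - s - 1) =
          (s - 1) * (((x + 1 : ℝ) : ℂ) ^ (-s) - (u : ℂ) ^ (-s)) := by
        rw [show (1 - s - 1) = -s by ring]; ring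
      rw [this, norm_mul]
      gcongr
      exact hB u hu)
    (convex_Icc _ _) ⟨le_rfl, by linarith⟩ ⟨by linarith, le_rfl⟩
  have e : zetaCorrection x s =
      (s - 1) * ((x + 1 : ℝ) : ℂ) ^ (-s) * ((x + 1 : ℝ) : ℂ) + ((x + 1 : ℝ) : ℂ) ^ (1 - s) -
        ((s - 1) * ((x + 1 : ℝ) : ℂ) ^ (-s) * (x : ℂ) + (x : ℂ) ^ (1 - s)) := by
    rw [zetaCorrection]; push_cast; ring
  rw [e]
  refine key.trans (by simp)

lemma norm_zetaCorrection_le {x : ℝ} (hx : 0 < x) {s : ℂ} (hs : 0 < s.re) :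
    ‖zetaCorrection x s‖ ≤ ‖s - 1‖ * (‖s‖ * x ^ (-s.re - 1)) :=
  norm_zetaCorrection_le_of_forall hx fun _ hy => norm_cpow_neg_sub_cpow_neg_le hx hs hy

/-- Interpolation between the trivial bound and the mean value bound. -/
lemma norm_zetaCorrection_le_rpow {x : ℝ} (hx : 0 < x) {s : ℂ} (hs : 0 < s.re) {θ : ℝ}
    (hθ0 : 0 ≤ θ) (hθ1 : θ ≤ 1) :
    ‖zetaCorrection x s‖ ≤ ‖s - 1‖ * (2 * ‖s‖ ^ θ * x ^ (-s.re - θ)) := by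
  refine norm_zetaCorrection_le_of_forall hx fun y hy => ?_
  set A := ‖((x + 1 : ℝ) : ℂ) ^ (-s) - (y : ℂ) ^ (-s)‖
  have hA : 0 ≤ A := norm_nonneg _
  have h1 : A ≤ ‖s‖ * x ^ (-s.re - 1) := norm_cpow_neg_sub_cpow_neg_le hx hs hy
  have h2 : A ≤ 2 * x ^ (-s.re) := norm_cpow_neg_sub_cpow_neg_le_two hx hs hy
  calc A = A ^ θ * A ^ (1 - θ) := by
        rw [← Real.rpow_add_of_nonneg hA hθ0 (by linarith)]; simp
    _ ≤ (‖s‖ * x ^ (-s.re - 1)) ^ θ * (2 * x ^ (-s.re)) ^ (1 - θ) := by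
        gcongr
    _ = 2 ^ (1 - θ) * ‖s‖ ^ θ * x ^ (-s.re - θ) := by
        rw [Real.mul_rpow (norm_nonneg _) (by positivity), Real.mul_rpow (by norm_num)
          (by positivity), ← Real.rpow_mul hx.le, ← Real.rpow_mul hx.le]
        rw [show -s.re - θ = (-s.re - 1) * θ + -s.re * (1 - θ) by ring, Real.rpow_add hx]
        ring
    _ ≤ 2 * ‖s‖ ^ θ * x ^ (-s.re - θ) := by
        gcongr
        calc (2 : ℝ) ^ (1 - θ) ≤ 2 ^ (1 : ℝ) :=
              Real.rpow_le_rpow_of_exponent_le (by norm_num) (by linarith)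
          _ = 2 := by simp

lemma differentiable_zetaCorrection {x : ℝ} (hx : 0 < x) :
    Differentiable ℂ (zetaCorrection x) := by
  have h1 : ((x + 1 : ℝ) : ℂ) ≠ 0 := by exact_mod_cast (by positivity : x + 1 ≠ 0)
  have h2 : (x : ℂ) ≠ 0 := by exact_mod_cast hx.ne'
  unfold zetaCorrection
  intro s
  have a1 : DifferentiableAt ℂ (fun s : ℂ => ((x + 1 : ℝ) : ℂ) ^ (-s)) s :=
    (differentiableAt_id.neg).const_cpow (Or.inl h1)
  have a2 : DifferentiableAt ℂ (fun s : ℂ => ((x + 1 : ℝ) : ℂ) ^ (1 - s)) s :=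
    (differentiableAt_id.const_sub 1).const_cpow (Or.inl h1)
  have a3 : DifferentiableAt ℂ (fun s : ℂ => (x : ℂ) ^ (1 - s)) s :=
    (differentiableAt_id.const_sub 1).const_cpow (Or.inl h2)
  exact ((differentiableAt_id.sub_const 1).mul a1).add (a2.sub a3)

lemma summable_nat_add_one_rpow {p : ℝ} (hp : p < -1) :
    Summable fun n : ℕ => ((n : ℝ) + 1) ^ p := by
  have := (summable_nat_add_iff 1).mpr (Real.summable_nat_rpow.mpr hp)
  simpa using this

lemma riemannZeta₁_eq_of_one_lt_re {s : ℂ} (hs : 1 < s.re) :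
    riemannZeta₁ s = s + ∑' n : ℕ, zetaCorrection (n + 1) s := by
  have hs1 : s ≠ 1 := by rintro rfl; simp at hs
  have hz : riemannZeta₁ s = (s - 1) * riemannZeta s := by
    rw [riemannZeta_eq_inv_sub_mul hs1, ← mul_assoc, mul_inv_cancel₀ (sub_ne_zero.mpr hs1), one_mul]
  have hsum : Summable fun n : ℕ => 1 / (n : ℂ) ^ s := Complex.summable_one_div_nat_cpow.mpr hs
  have hsum1 : Summable fun n : ℕ => 1 / ((n : ℂ) + 1) ^ s := by
    simpa using (summable_nat_add_iff 1).mpr hsum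
  have hsum2 : HasSum (fun n : ℕ => 1 / ((n : ℂ) + 1 + 1) ^ s) (riemannZeta s - 1) := by
    have h := (hasSum_nat_add_iff' 1).mpr hsum1.hasSum
    rw [← zeta_eq_tsum_one_div_nat_add_one_cpow hs] at h
    simpa using h
  have hcs : Summable fun n : ℕ => zetaCorrection (n + 1) s := by
    refine Summable.of_norm_bounded
      (g := fun n : ℕ => ‖s - 1‖ * (‖s‖ * ((n : ℝ) + 1) ^ (-s.re - 1))) ?_
      (fun n => norm_zetaCorrection_le (by positivity) (by linarith))
    exact ((summable_nat_add_one_rpow (by linarith)).mul_left _).mul_left _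
  have hsum3 := hsum2.mul_left (s - 1)
  have htel := hcs.hasSum.sub hsum3
  have hlim := htel.tendsto_sum_nat
  have hpart : ∀ N : ℕ, ∑ n ∈ Finset.range N, (zetaCorrection (n + 1) s -
      (s - 1) * (1 / ((n : ℂ) + 1 + 1) ^ s)) = ((N : ℂ) + 1) ^ (1 - s) - 1 := by
    intro N
    have htele := Finset.sum_range_sub (fun n : ℕ => ((n : ℂ) + 1) ^ (1 - s)) N
    simp only [Nat.cast_zero, zero_add, Complex.one_cpow] at htele
    rw [← htele]
    refine Finset.sum_congr rfl fun n _ => ?_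
    rw [zetaCorrection, Complex.cpow_neg]
    push_cast
    ring
  have hlim2 : Tendsto (fun N : ℕ => ((N : ℂ) + 1) ^ (1 - s) - 1) atTop (𝓝 (0 - 1)) := by
    refine Tendsto.sub_const ?_ 1
    rw [tendsto_zero_iff_norm_tendsto_zero]
    have : ∀ N : ℕ, ‖((N : ℂ) + 1) ^ (1 - s)‖ = ((N : ℝ) + 1) ^ (-(s.re - 1)) := fun N => by
      rw [show ((N : ℂ) + 1) = (((N : ℝ) + 1 : ℝ) : ℂ) by push_cast; ring,
        Complex.norm_cpow_eq_rpow_re_of_pos (by positivity)]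
      simp
    simp only [this]
    exact (tendsto_rpow_neg_atTop (by linarith)).comp
      (tendsto_atTop_add_const_right _ _ tendsto_natCast_atTop_atTop)
  have huniq := tendsto_nhds_unique hlim (by simpa only [hpart] using hlim2)
  rw [hz]
  linear_combination -huniq

lemma riemannZeta₁_eq {s : ℂ} (hs : 9 / 10 < s.re) :
    riemannZeta₁ s = s + ∑' n : ℕ, zetaCorrection (n + 1) s := by
  set R : ℝ := ‖s‖ + 3
  set U : Set ℂ := {z | 9 / 10 < z.re} ∩ Metric.ball 0 R
  have hUo : IsOpen U := (isOpen_lt continuous_const Complex.continuous_re).inter Metric.isOpen_ball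
  have hUc : Convex ℝ U := (convex_halfSpace_re_gt _).inter (convex_ball _ _)
  have hd : DifferentiableOn ℂ (fun z => ∑' n : ℕ, zetaCorrection (n + 1) z) U := by
    refine differentiableOn_tsum_of_summable_norm
      (u := fun n : ℕ => (R + 1) * (R * ((n : ℝ) + 1) ^ (-(19 / 10) : ℝ))) ?_
      (fun n => (differentiable_zetaCorrection (by positivity)).differentiableOn) hUo ?_
    · exact ((summable_nat_add_one_rpow (by norm_num)).mul_left _).mul_left _
    · intro n z hz
      have hzR : ‖z‖ ≤ R := by simpa using (Metric.mem_ball.mp hz.2).le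
      have hre : 9 / 10 < z.re := hz.1
      refine (norm_zetaCorrection_le (by positivity) (by linarith)).trans ?_
      have h1 : ‖z - 1‖ ≤ R + 1 := (norm_sub_le _ _).trans (by simpa using hzR)
      gcongr
      · linarith
      · linarith
  have h2 : (2 : ℂ) ∈ U := by
    refine ⟨by norm_num, ?_⟩
    rw [Metric.mem_ball, dist_zero_right]
    norm_num [R]
    linarith [norm_nonneg s]
  refine AnalyticOnNhd.eqOn_of_preconnected_of_eventuallyEq (z₀ := 2)
    (f := riemannZeta₁) (g := fun s => s + ∑' n : ℕ, zetaCorrection (n + 1) s) (U := U)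
    (differentiable_riemannZeta₁.differentiableOn.analyticOnNhd hUo)
    ((differentiableOn_id.add hd).analyticOnNhd hUo) hUc.isPreconnected h2 ?_ ⟨hs, ?_⟩
  · have : {z : ℂ | 1 < z.re} ∈ 𝓝 (2 : ℂ) :=
      (isOpen_lt continuous_const Complex.continuous_re).mem_nhds (by norm_num)
    filter_upwards [this] with z hz using riemannZeta₁_eq_of_one_lt_re hz
  · simp [R]

lemma exists_norm_riemannZeta_le :
    ∃ A : ℝ, 1 ≤ A ∧ ∀ s : ℂ, 19 / 20 ≤ s.re → s.re ≤ 4 → 1 ≤ |s.im| →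
      ‖riemannZeta s‖ ≤ A * |s.im| ^ (1 / 10 : ℝ) := by
  set S : ℝ := ∑' n : ℕ, ((n : ℝ) + 1) ^ (-(21 / 20) : ℝ)
  have hSs : Summable fun n : ℕ => ((n : ℝ) + 1) ^ (-(21 / 20) : ℝ) :=
    summable_nat_add_one_rpow (by norm_num)
  have hS : 0 ≤ S := tsum_nonneg fun n => by positivity
  refine ⟨2 + 10 * S, by linarith, fun s h1 h2 h3 => ?_⟩
  have ht : (1 : ℝ) ≤ |s.im| ^ (1 / 10 : ℝ) := Real.one_le_rpow h3 (by norm_num)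
  have him : |s.im| ≤ ‖s - 1‖ := by simpa using Complex.abs_im_le_norm (s - 1)
  have hpos : 0 < ‖s - 1‖ := by linarith
  have hs1 : s ≠ 1 := by rintro rfl; simp at hpos
  have hns : ‖s‖ ≤ ‖s - 1‖ + 1 := by
    calc ‖s‖ = ‖(s - 1) + 1‖ := by simp
      _ ≤ _ := (norm_add_le _ _).trans (by simp)
  have hns5 : ‖s‖ ≤ 5 * |s.im| := by
    have := Complex.norm_le_abs_re_add_abs_im s
    rw [abs_of_nonneg (by linarith : 0 ≤ s.re)] at this
    linarith
  have hnsr : ‖s‖ ^ (1 / 10 : ℝ) ≤ 5 * |s.im| ^ (1 / 10 : ℝ) := by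
    calc ‖s‖ ^ (1 / 10 : ℝ) ≤ (5 * |s.im|) ^ (1 / 10 : ℝ) := by gcongr
      _ = 5 ^ (1 / 10 : ℝ) * |s.im| ^ (1 / 10 : ℝ) := Real.mul_rpow (by norm_num) (abs_nonneg _)
      _ ≤ 5 * |s.im| ^ (1 / 10 : ℝ) := by
        gcongr
        calc (5 : ℝ) ^ (1 / 10 : ℝ) ≤ 5 ^ (1 : ℝ) :=
              Real.rpow_le_rpow_of_exponent_le (by norm_num) (by norm_num)
          _ = 5 := by simp
  have hterm : ∀ n : ℕ, ‖zetaCorrection (n + 1) s‖ ≤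
      ‖s - 1‖ * (2 * ‖s‖ ^ (1 / 10 : ℝ)) * ((n : ℝ) + 1) ^ (-(21 / 20) : ℝ) := fun n => by
    refine (norm_zetaCorrection_le_rpow (θ := 1 / 10) (by positivity) (by linarith) (by norm_num)
      (by norm_num)).trans ?_
    rw [← mul_assoc]
    gcongr
    · linarith
    · linarith
  have hts : ‖∑' n : ℕ, zetaCorrection (n + 1) s‖ ≤
      ‖s - 1‖ * (2 * ‖s‖ ^ (1 / 10 : ℝ)) * S :=
    tsum_of_norm_bounded (hSs.hasSum.mul_left _) hterm
  rw [riemannZeta_eq_inv_sub_mul hs1, riemannZeta₁_eq (by linarith), norm_mul, norm_inv,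
    inv_mul_le_iff₀ hpos]
  calc ‖s + ∑' n : ℕ, zetaCorrection (n + 1) s‖
      ≤ (‖s - 1‖ + 1) + ‖s - 1‖ * (2 * ‖s‖ ^ (1 / 10 : ℝ)) * S :=
        (norm_add_le _ _).trans (add_le_add hns hts)
    _ ≤ (‖s - 1‖ + ‖s - 1‖) + ‖s - 1‖ * (2 * (5 * |s.im| ^ (1 / 10 : ℝ))) * S := by
        gcongr; linarith
    _ = ‖s - 1‖ * (2 * 1 + 10 * S * |s.im| ^ (1 / 10 : ℝ)) := by ring
    _ ≤ ‖s - 1‖ * (2 * |s.im| ^ (1 / 10 : ℝ) + 10 * S * |s.im| ^ (1 / 10 : ℝ)) := by gcongr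
    _ = _ := by ring

lemma diffContOnCl_riemannZeta_ball {s : ℂ} (hs : 2 ≤ |s.im|) :
    DiffContOnCl ℂ riemannZeta (Metric.ball s (1 / 20)) := by
  refine DifferentiableOn.diffContOnCl fun z hz => ?_
  refine (differentiableAt_riemannZeta ?_).differentiableWithinAt
  rintro rfl
  rw [closure_ball _ (by norm_num), Metric.mem_closedBall, dist_eq_norm] at hz
  have := Complex.abs_im_le_norm (1 - s)
  simp at this
  linarith

lemma exists_norm_deriv_riemannZeta_le :
    ∃ B : ℝ, 1 ≤ B ∧ ∀ s : ℂ, 1 ≤ s.re → s.re ≤ 2 → 2 ≤ |s.im| →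
      ‖deriv riemannZeta s‖ ≤ B * |s.im| ^ (1 / 10 : ℝ) ∧
      ‖deriv (deriv riemannZeta) s‖ ≤ B * |s.im| ^ (1 / 10 : ℝ) := by
  obtain ⟨A, hA1, hA⟩ := exists_norm_riemannZeta_le
  refine ⟨1600 * A, by linarith, fun s h1 h2 h3 => ?_⟩
  have hsph : ∀ z ∈ Metric.sphere s (1 / 20), ‖riemannZeta z‖ ≤
      2 * A * |s.im| ^ (1 / 10 : ℝ) := fun z hz => by
    rw [Metric.mem_sphere, dist_eq_norm] at hz
    have hre := Complex.abs_re_le_norm (z - s)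
    have him := Complex.abs_im_le_norm (z - s)
    rw [hz, Complex.sub_re, abs_le] at hre
    rw [hz, Complex.sub_im] at him
    have e1 := abs_sub_abs_le_abs_sub z.im s.im
    have e2 := abs_sub_abs_le_abs_sub s.im z.im
    rw [abs_sub_comm] at e2
    calc ‖riemannZeta z‖ ≤ A * |z.im| ^ (1 / 10 : ℝ) :=
          hA z (by linarith) (by linarith) (by linarith)
      _ ≤ A * (2 * |s.im|) ^ (1 / 10 : ℝ) := by gcongr; linarith
      _ = A * (2 ^ (1 / 10 : ℝ) * |s.im| ^ (1 / 10 : ℝ)) := by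
          rw [Real.mul_rpow (by norm_num) (abs_nonneg _)]
      _ ≤ A * (2 * |s.im| ^ (1 / 10 : ℝ)) := by
          gcongr
          calc (2 : ℝ) ^ (1 / 10 : ℝ) ≤ 2 ^ (1 : ℝ) :=
                Real.rpow_le_rpow_of_exponent_le (by norm_num) (by norm_num)
            _ = 2 := by simp
      _ = _ := by ring
  have hd := diffContOnCl_riemannZeta_ball h3
  have hnn : 0 ≤ A * |s.im| ^ (1 / 10 : ℝ) := by positivity
  constructor
  · refine (Complex.norm_deriv_le_of_forall_mem_sphere_norm_le (by norm_num) hd hsph).trans ?_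
    linarith
  · have := Complex.norm_iteratedDeriv_le_of_forall_mem_sphere_norm_le 2 (by norm_num) hd hsph
    rw [iteratedDeriv_succ, iteratedDeriv_one] at this
    refine this.trans ?_
    norm_num
    linarith

lemma exists_norm_riemannZeta_ofReal_le :
    ∃ M : ℝ, 1 ≤ M ∧ ∀ x : ℝ, 0 < x → x ≤ 1 → ‖riemannZeta (1 + x)‖ ≤ M / x := by
  obtain ⟨M, hM⟩ := isCompact_Icc.exists_bound_of_continuousOn (s := Set.Icc (0 : ℝ) 1)
    (f := fun x : ℝ => riemannZeta₁ (1 + x))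
    (differentiable_riemannZeta₁.continuous.comp
      (continuous_const.add Complex.continuous_ofReal)).continuousOn
  refine ⟨max M 1, le_max_right _ _, fun x h0 h1 => ?_⟩
  have hx : (1 + x : ℂ) ≠ 1 := by simpa using h0.ne'
  rw [riemannZeta_eq_inv_sub_mul hx, norm_mul, norm_inv, add_sub_cancel_left, Complex.norm_real,
    Real.norm_of_nonneg h0.le, div_eq_inv_mul]
  gcongr
  exact (hM x ⟨h0.le, h1⟩).trans (le_max_left _ _)

lemma exists_le_norm_riemannZeta_pow_four :
    ∃ c : ℝ, 0 < c ∧ c ≤ 1 ∧ ∀ x t : ℝ, 0 < x → x ≤ 1 → 2 ≤ |t| →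
      c ^ 4 * x ^ 3 * |t| ^ (-(1 / 10) : ℝ) ≤ ‖riemannZeta (1 + x + t * I)‖ ^ 4 := by
  obtain ⟨A, hA1, hA⟩ := exists_norm_riemannZeta_le
  obtain ⟨M, hM1, hM⟩ := exists_norm_riemannZeta_ofReal_le
  have hD : 1 ≤ 2 * A * M ^ 3 := by
    have : 1 ≤ M ^ 3 := one_le_pow₀ hM1
    nlinarith
  refine ⟨(2 * A * M ^ 3)⁻¹, by positivity, inv_le_one_of_one_le₀ hD, fun x t h0 h1 ht => ?_⟩
  have ht0 : 0 < |t| := by linarith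
  have key := DirichletCharacter.norm_LFunction_product_ge_one (N := 1) 1 h0 t
  rw [DirichletCharacter.LFunctionTrivChar, DirichletCharacter.LFunction_modOne_eq,
    DirichletCharacter.LFunction_modOne_eq] at key
  rw [norm_mul, norm_mul, norm_pow, norm_pow] at key
  have hz2 : ‖riemannZeta (1 + x + 2 * I * t)‖ ≤ 2 * A * |t| ^ (1 / 10 : ℝ) := by
    have e : |(1 + x + 2 * I * t : ℂ).im| = 2 * |t| := by simp [abs_mul]
    have h := hA (1 + x + 2 * I * t) (by simp; linarith) (by simp; linarith) (by
      rw [e]; linarith)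
    rw [e, Real.mul_rpow (by norm_num) (abs_nonneg _)] at h
    refine h.trans ?_
    have : (2 : ℝ) ^ (1 / 10 : ℝ) ≤ 2 := by
      calc (2 : ℝ) ^ (1 / 10 : ℝ) ≤ 2 ^ (1 : ℝ) :=
            Real.rpow_le_rpow_of_exponent_le (by norm_num) (by norm_num)
        _ = 2 := by simp
    calc A * (2 ^ (1 / 10 : ℝ) * |t| ^ (1 / 10 : ℝ)) ≤ A * (2 * |t| ^ (1 / 10 : ℝ)) := by gcongr
      _ = _ := by ring
  rw [mul_comm I (t : ℂ)] at key
  set Z := ‖riemannZeta (1 + x + t * I)‖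
  set T := |t| ^ (1 / 10 : ℝ)
  have hT : 0 < T := by positivity
  have hTi : |t| ^ (-(1 / 10) : ℝ) = T⁻¹ := Real.rpow_neg ht0.le _
  have h2 : 1 ≤ (M / x) ^ 3 * Z ^ 4 * (2 * A * T) := by
    refine le_trans key ?_
    gcongr
    exact hM x h0 h1
  have hc4 : ((2 * A * M ^ 3)⁻¹) ^ 4 ≤ (2 * A * M ^ 3)⁻¹ :=
    pow_le_of_le_one (by positivity) (inv_le_one_of_one_le₀ hD) (by norm_num)
  rw [hTi]
  calc ((2 * A * M ^ 3)⁻¹) ^ 4 * x ^ 3 * T⁻¹ ≤ (2 * A * M ^ 3)⁻¹ * x ^ 3 * T⁻¹ := by gcongr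
    _ = (2 * A * M ^ 3)⁻¹ * x ^ 3 * T⁻¹ * 1 := by ring
    _ ≤ (2 * A * M ^ 3)⁻¹ * x ^ 3 * T⁻¹ * ((M / x) ^ 3 * Z ^ 4 * (2 * A * T)) := by gcongr
    _ = Z ^ 4 := by field_simp

lemma exists_le_norm_riemannZeta :
    ∃ c : ℝ, 0 < c ∧ ∀ σ t : ℝ, 1 ≤ σ → σ ≤ 2 → 2 ≤ |t| →
      c * (|t| ^ (-(1 / 10) : ℝ)) ^ 4 ≤ ‖riemannZeta (σ + t * I)‖ := by
  obtain ⟨c, hc0, hc1, hc⟩ := exists_le_norm_riemannZeta_pow_four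
  obtain ⟨B, hB1, hB⟩ := exists_norm_deriv_riemannZeta_le
  set l : ℝ := c / (2 * B)
  have hl0 : 0 < l := by positivity
  have hl1 : l ≤ 1 := (div_le_one (by positivity)).mpr (by linarith)
  refine ⟨c * l ^ 3 / 2, by positivity, fun σ t h1 h2 ht => ?_⟩
  have ht0 : 0 < |t| := by linarith
  set u : ℝ := |t| ^ (-(1 / 10) : ℝ) with hu
  have hu0 : 0 < u := by positivity
  have hu1 : u ≤ 1 := Real.rpow_le_one_of_one_le_of_nonpos (by linarith) (by norm_num)
  have hui : |t| ^ (1 / 10 : ℝ) = u⁻¹ := by rw [hu, Real.rpow_neg ht0.le, inv_inv]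
  set η : ℝ := l ^ 4 * u ^ 5 with hη
  have hη0 : 0 < η := by positivity
  have hη1 : η ≤ 1 := mul_le_one₀ (pow_le_one₀ hl0.le hl1) (by positivity) (pow_le_one₀ hu0.le hu1)
  have far : ∀ x : ℝ, η ≤ x → x ≤ 1 → c * l ^ 3 * u ^ 4 ≤ ‖riemannZeta (1 + x + t * I)‖ := by
    intro x hx hx1
    refine le_of_pow_le_pow_left₀ (n := 4) (by norm_num) (norm_nonneg _) ?_
    calc (c * l ^ 3 * u ^ 4) ^ 4 = c ^ 4 * η ^ 3 * u := by rw [hη]; ring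
      _ ≤ c ^ 4 * x ^ 3 * u := by gcongr
      _ ≤ _ := hc x t (hη0.trans_le hx) hx1 ht
  rcases le_or_gt (1 + η) σ with h | h
  · have := far (σ - 1) (by linarith) (by linarith)
    push_cast at this
    rw [add_sub_cancel] at this
    refine le_trans ?_ this
    have : 0 ≤ c * l ^ 3 * u ^ 4 := by positivity
    linarith
  · have hfar := far η le_rfl hη1
    have hmv := Convex.norm_image_sub_le_of_norm_hasDerivWithin_le (𝕜 := ℝ)
      (f := fun v : ℝ => riemannZeta (v + t * I))
      (f' := fun v : ℝ => deriv riemannZeta (v + t * I))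
      (s := Set.Icc 1 2) (x := σ) (y := 1 + η) (C := B * u⁻¹)
      (fun v hv => by
        have hne : (v + t * I : ℂ) ≠ 1 := fun e => by
          have := congrArg Complex.im e
          simp at this
          simp [this] at ht0
        have hd := (differentiableAt_riemannZeta hne).hasDerivAt
        have := (HasDerivAt.comp_add_const (v : ℂ) (t * I) hd).comp_ofReal
        exact this.hasDerivWithinAt)
      (fun v hv => by
        have := (hB (v + t * I) (by simpa using hv.1) (by simpa using hv.2) (by simpa using ht)).1
        rw [← hui]; simpa using this)
      (convex_Icc _ _) ⟨h1, h2⟩ ⟨by linarith, by linarith⟩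
    have e : ((1 + η : ℝ) : ℂ) = 1 + η := by push_cast; ring
    simp only [e] at hmv
    have hb : B * u⁻¹ * ‖1 + η - σ‖ ≤ c * l ^ 3 * u ^ 4 / 2 := by
      rw [Real.norm_of_nonneg (by linarith)]
      calc B * u⁻¹ * (1 + η - σ) ≤ B * u⁻¹ * η := by gcongr; linarith
        _ = B * l * l ^ 3 * u ^ 4 := by rw [hη]; field_simp
        _ = c * l ^ 3 * u ^ 4 / 2 := by
          have : B * l = c / 2 := by simp only [l]; field_simp
          rw [this]; ring
    have := norm_sub_norm_le (riemannZeta (1 + η + t * I)) (riemannZeta (σ + t * I))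
    linarith

lemma zetaLogDerivDeriv_eq {s : ℂ} (hs : 1 ≤ s.re) (hs1 : s ≠ 1) :
    zetaLogDerivDeriv s = (deriv (deriv riemannZeta) s * riemannZeta s -
      deriv riemannZeta s * deriv riemannZeta s) / riemannZeta s ^ 2 := by
  have hd : DifferentiableAt ℂ (deriv riemannZeta) s :=
    (DifferentiableOn.deriv (fun z hz => (differentiableAt_riemannZeta hz).differentiableWithinAt)
      isOpen_compl_singleton).differentiableAt (isOpen_compl_singleton.mem_nhds hs1)
  rw [zetaLogDerivDeriv]
  exact deriv_fun_div hd (differentiableAt_riemannZeta hs1) (riemannZeta_ne_zero_of_one_le_re hs)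

lemma continuousAt_zetaLogDerivDeriv {s : ℂ} (hs : 1 ≤ s.re) (hs1 : s ≠ 1) :
    ContinuousAt zetaLogDerivDeriv s := by
  have h0 : AnalyticAt ℂ riemannZeta s :=
    DifferentiableOn.analyticAt (s := {1}ᶜ)
      (fun z hz => (differentiableAt_riemannZeta hz).differentiableWithinAt)
      (isOpen_compl_singleton.mem_nhds hs1)
  exact ((h0.deriv.fun_div h0 (riemannZeta_ne_zero_of_one_le_re hs)).deriv).continuousAt

lemma exists_norm_zetaLogDerivDeriv_le_of_two_le :
    ∃ C : ℝ, 0 < C ∧ ∀ σ t : ℝ, 1 ≤ σ → σ ≤ 2 → 2 ≤ |t| →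
      ‖zetaLogDerivDeriv (σ + t * I)‖ ≤ C * |t| := by
  obtain ⟨c, hc0, hc⟩ := exists_le_norm_riemannZeta
  obtain ⟨B, hB1, hB⟩ := exists_norm_deriv_riemannZeta_le
  refine ⟨B / c + B ^ 2 / c ^ 2, by positivity, fun σ t h1 h2 ht => ?_⟩
  have ht0 : 0 < |t| := by linarith
  have hne : (σ + t * I : ℂ) ≠ 1 := fun e => by
    have := congrArg Complex.im e
    simp at this
    simp [this] at ht0
  have hlow := hc σ t h1 h2 ht
  obtain ⟨hB', hB''⟩ := hB (σ + t * I) (by simpa using h1) (by simpa using h2) (by simpa using ht)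
  have him : (σ + t * I : ℂ).im = t := by simp
  rw [him] at hB' hB''
  rw [zetaLogDerivDeriv_eq (by simpa using h1) hne]
  have hz0 : riemannZeta (σ + t * I) ≠ 0 := riemannZeta_ne_zero_of_one_le_re (by simpa using h1)
  set Z := riemannZeta (σ + t * I)
  set Z' := deriv riemannZeta (σ + t * I)
  set Z'' := deriv (deriv riemannZeta) (σ + t * I)
  set v : ℝ := |t| ^ (1 / 10 : ℝ) with hv
  have hv0 : 0 < v := by positivity
  have hv1 : 1 ≤ v := Real.one_le_rpow (by linarith) (by norm_num)
  have hvu : |t| ^ (-(1 / 10) : ℝ) = v⁻¹ := Real.rpow_neg ht0.le _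
  have hv10 : v ^ 10 = |t| := by
    rw [hv, ← Real.rpow_natCast, ← Real.rpow_mul ht0.le]; norm_num
  rw [hvu] at hlow
  have hlow0 : 0 < c * v⁻¹ ^ 4 := by positivity
  have e : (Z'' * Z - Z' * Z') / Z ^ 2 = Z'' / Z - Z' ^ 2 / Z ^ 2 := by field_simp
  rw [e]
  calc ‖Z'' / Z - Z' ^ 2 / Z ^ 2‖ ≤ ‖Z''‖ / ‖Z‖ + ‖Z'‖ ^ 2 / ‖Z‖ ^ 2 := by
        refine (norm_sub_le _ _).trans (le_of_eq ?_)
        simp [norm_pow]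
    _ ≤ (B * v) / (c * v⁻¹ ^ 4) + (B * v) ^ 2 / (c * v⁻¹ ^ 4) ^ 2 := by gcongr
    _ = B / c * v ^ 5 + B ^ 2 / c ^ 2 * v ^ 10 := by field_simp
    _ ≤ B / c * v ^ 10 + B ^ 2 / c ^ 2 * v ^ 10 := by
        gcongr
        · norm_num
    _ = _ := by rw [hv10]; ring

lemma exists_norm_zetaLogDerivDeriv_le {δ : ℝ} (hδ : 0 < δ) :
    ∃ C : ℝ, 0 < C ∧ ∀ σ t : ℝ, 1 ≤ σ → σ ≤ 2 → δ ≤ |t| →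
      ‖zetaLogDerivDeriv (σ + t * I)‖ ≤ C * |t| := by
  obtain ⟨C, hC0, hC⟩ := exists_norm_zetaLogDerivDeriv_le_of_two_le
  set S : Set ℂ := (Set.Icc (1 : ℝ) 2) ×ℂ ({t : ℝ | δ ≤ |t|} ∩ Set.Icc (-2) 2)
  have hS : IsCompact S := isCompact_Icc.reProdIm
    (isCompact_Icc.inter_left (isClosed_le continuous_const continuous_abs))
  obtain ⟨D, hD⟩ := hS.exists_bound_of_continuousOn (f := zetaLogDerivDeriv) (fun z hz => by
    obtain ⟨hz1, hz2, -⟩ := hz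
    refine (continuousAt_zetaLogDerivDeriv hz1.1 ?_).continuousWithinAt
    rintro rfl
    simp at hz2
    linarith)
  refine ⟨max C (D / δ), lt_max_of_lt_left hC0, fun σ t h1 h2 ht => ?_⟩
  rcases le_total 2 |t| with h | h
  · exact (hC σ t h1 h2 h).trans (by gcongr; exact le_max_left _ _)
  · have hb := hD (σ + t * I) ⟨by simpa using ⟨h1, h2⟩, by simpa using ht,
      by simpa using abs_le.mp h⟩
    have hD0 : 0 ≤ D := (norm_nonneg _).trans hb
    calc _ ≤ D := hb
      _ = D / δ * δ := by field_simp
      _ ≤ D / δ * |t| := by gcongr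
      _ ≤ _ := by gcongr; exact le_max_right _ _

section Fourier

open scoped FourierTransform

lemma FT_eq_fourier (h : ℝ → ℂ) : FT h = 𝓕 h := by
  ext ξ
  rw [FT, Real.fourier_real_eq_integral_exp_smul]
  refine integral_congr_ae (Eventually.of_forall fun x => ?_)
  simp only [smul_eq_mul]
  rw [mul_comm]
  congr 2
  push_cast
  ring

lemma MemH.exists_norm_FT_le {h : ℝ → ℂ} (hh : MemH h) :
    ∃ C : ℝ, 0 ≤ C ∧ ∀ ξ : ℝ, 1 ≤ ξ → ‖FT h ξ‖ ≤ C * ξ ^ (-4 : ℝ) := by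
  obtain ⟨C, hC⟩ := hh.ft_deriv_decay
  have hC0 : 0 ≤ C := by simpa using (norm_nonneg _).trans (hC 1 (by simp))
  refine ⟨C, hC0, fun ξ hξ => ?_⟩
  have hdiff : ∀ x, HasDerivAt (FT h) (deriv (FT h) x) x := fun x => by
    rw [FT_eq_fourier]
    exact (Real.hasDerivAt_fourier hh.integrable (by simpa using hh.xh_integrable)
      x).differentiableAt.hasDerivAt
  have hlim : Tendsto (FT h) atTop (𝓝 0) := by
    rw [FT_eq_fourier]
    exact (Real.zero_at_infty_fourier h).mono_left atTop_le_cocompact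
  have hbnd : ∀ x ∈ Set.Ioi ξ, ‖deriv (FT h) x‖ ≤ C * x ^ (-5 : ℝ) := fun x hx => by
    have hx1 : 1 ≤ x := hξ.trans (le_of_lt hx)
    simpa [abs_of_nonneg (zero_le_one.trans hx1)] using hC x (hx1.trans (le_abs_self x))
  have hpow : IntegrableOn (fun x : ℝ => C * x ^ (-5 : ℝ)) (Set.Ioi ξ) :=
    (integrableOn_Ioi_rpow_of_lt (by norm_num) (by linarith)).const_mul C
  have hint : IntegrableOn (deriv (FT h)) (Set.Ioi ξ) :=
    Integrable.mono' hpow (stronglyMeasurable_deriv _).aestronglyMeasurable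
      ((ae_restrict_iff' measurableSet_Ioi).mpr (Eventually.of_forall hbnd))
  have hval := integral_Ioi_of_hasDerivAt_of_tendsto (hdiff ξ).continuousAt.continuousWithinAt
    (fun x _ => hdiff x) hint hlim
  have hle := norm_integral_le_of_norm_le hpow
    ((ae_restrict_iff' measurableSet_Ioi).mpr (Eventually.of_forall hbnd))
  rw [hval, zero_sub, norm_neg, integral_const_mul,
    integral_Ioi_rpow_of_lt (by norm_num) (by linarith)] at hle
  refine hle.trans ?_
  norm_num
  have : 0 ≤ C * ξ ^ (-4 : ℝ) := by positivity
  norm_num at this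
  linarith

lemma summable_one_div_nat_mul_one_add_log_sq :
    Summable fun n : ℕ => 1 / ((n : ℝ) * (1 + Real.log n) ^ 2) := by
  rw [← summable_condensed_iff_of_nonneg]
  · have hl : 0 < Real.log 2 := Real.log_pos (by norm_num)
    have hs : Summable fun k : ℕ => ((Real.log 2) ^ 2)⁻¹ * (1 / (k : ℝ) ^ 2) :=
      (Real.summable_one_div_nat_pow.mpr (by norm_num)).mul_left _
    refine (summable_nat_add_iff 1).mp
      (Summable.of_nonneg_of_le (fun k => by positivity) (fun k => ?_)
        ((summable_nat_add_iff 1).mpr hs))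
    push_cast
    rw [Real.log_pow]
    push_cast
    have h1 : (2 : ℝ) ^ (k + 1) * (1 / (2 ^ (k + 1) * (1 + (k + 1) * Real.log 2) ^ 2)) =
        1 / (1 + (k + 1) * Real.log 2) ^ 2 := by field_simp
    have h2 : ((Real.log 2) ^ 2)⁻¹ * (1 / ((k : ℝ) + 1) ^ 2) =
        1 / ((k + 1) * Real.log 2) ^ 2 := by field_simp
    rw [h1, h2]
    gcongr
    linarith
  · intro n
    positivity
  · intro m n hm hmn
    have hm' : (0 : ℝ) < m := by exact_mod_cast hm
    have hmn' : (m : ℝ) ≤ n := by exact_mod_cast hmn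
    have hl : 0 ≤ Real.log m := Real.log_natCast_nonneg m
    gcongr

lemma MemH.summable_norm_vonMangoldt_FT {h : ℝ → ℂ} (hh : MemH h) :
    Summable (fun n : ℕ =>
      ‖((ArithmeticFunction.vonMangoldt n : ℂ) ^ 2 / (n : ℂ)) *
          FT h (Real.log n / (2 * Real.pi))‖) := by
  obtain ⟨C, hC0, hC⟩ := hh.exists_norm_FT_le
  have hs := summable_one_div_nat_mul_one_add_log_sq.mul_left (4 * C * (2 * Real.pi) ^ 4)
  refine Summable.of_norm_bounded_eventually_nat hs ?_
  have hpi : 1 ≤ 2 * Real.pi := by linarith [Real.pi_gt_three]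
  have hev : ∀ᶠ n : ℕ in atTop, 2 * Real.pi ≤ Real.log n :=
    (Real.tendsto_log_atTop.comp tendsto_natCast_atTop_atTop).eventually_ge_atTop _
  filter_upwards [hev, eventually_ge_atTop 1] with n hn hn1
  have hn0 : (0 : ℝ) < n := by exact_mod_cast hn1
  set l := Real.log n
  have hl0 : 0 < l := by linarith
  have hF := hC (l / (2 * Real.pi)) ((one_le_div (by positivity)).mpr hn)
  rw [show (-4 : ℝ) = -((4 : ℕ) : ℝ) by norm_num, Real.rpow_neg (by positivity),
    Real.rpow_natCast] at hF
  rw [norm_norm, norm_mul, norm_div, norm_pow, Complex.norm_real, Complex.norm_natCast,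
    Real.norm_of_nonneg ArithmeticFunction.vonMangoldt_nonneg]
  calc ArithmeticFunction.vonMangoldt n ^ 2 / n * ‖FT h (l / (2 * Real.pi))‖
      ≤ l ^ 2 / n * (C * ((l / (2 * Real.pi)) ^ 4)⁻¹) := by
        gcongr
        exact ArithmeticFunction.vonMangoldt_le_log
    _ = C * (2 * Real.pi) ^ 4 * (4 * (1 / (n * (l + l) ^ 2))) := by field_simp; ring
    _ ≤ C * (2 * Real.pi) ^ 4 * (4 * (1 / (n * (1 + l) ^ 2))) := by
        gcongr; linarith
    _ = _ := by ring

end Fourier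

lemma Nat.rad_le {m : ℕ} (hm : m ≠ 0) : m.rad ≤ m :=
  Nat.le_of_dvd (Nat.pos_of_ne_zero hm) (Nat.prod_primeFactors_dvd m)

lemma Nat.rad_prime_pow {p : ℕ} (hp : p.Prime) {k : ℕ} (hk : k ≠ 0) : (p ^ k).rad = p := by
  rw [Nat.rad, Nat.primeFactors_prime_pow hk hp, Finset.prod_singleton]

lemma Nat.Coprime.rad_mul {m n : ℕ} (h : m.Coprime n) : (m * n).rad = m.rad * n.rad := by
  rw [Nat.rad, h.primeFactors_mul, Finset.prod_union h.disjoint_primeFactors, Nat.rad, Nat.rad]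

lemma Nat.Coprime.rad_rad {m n : ℕ} (h : m.Coprime n) : m.rad.Coprime n.rad :=
  (h.coprime_dvd_left (Nat.prod_primeFactors_dvd m)).coprime_dvd_right
    (Nat.prod_primeFactors_dvd n)

lemma abs_bcoef_le {m : ℕ} (hm : m ≠ 0) : |bcoef m| ≤ m := by
  rw [bcoef, abs_mul, Nat.abs_cast]
  calc |ArithmeticFunction.moebius m.rad| * (Nat.totient m.rad : ℤ) ≤ 1 * (m : ℤ) := by
        gcongr
        · exact ArithmeticFunction.abs_moebius_le_one
        · exact (Nat.totient_le _).trans (Nat.rad_le hm)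
    _ = m := one_mul _

lemma bcoef_one : bcoef 1 = 1 := by simp [bcoef, Nat.rad]

lemma bcoef_prime_pow {p : ℕ} (hp : p.Prime) {k : ℕ} (hk : k ≠ 0) :
    bcoef (p ^ k) = 1 - p := by
  rw [bcoef, Nat.rad_prime_pow hp hk, ArithmeticFunction.moebius_apply_prime hp,
    Nat.totient_prime hp, Nat.cast_sub hp.one_le]
  push_cast
  ring

lemma bcoef_mul_of_coprime {m n : ℕ} (h : m.Coprime n) : bcoef (m * n) = bcoef m * bcoef n := by
  rw [bcoef, h.rad_mul, ArithmeticFunction.isMultiplicative_moebius.map_mul_of_coprime h.rad_rad,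
    Nat.totient_mul h.rad_rad, bcoef, bcoef]
  push_cast
  ring

lemma sum_divisorsAntidiagonal_prime_pow_bcoef_mul {p : ℕ} (hp : p.Prime) (i : ℕ) :
    ∑ x ∈ (p ^ i).divisorsAntidiagonal, bcoef x.1 * (x.2 : ℤ) = 1 := by
  rw [Nat.sum_divisorsAntidiagonal (fun a b : ℕ => bcoef a * (b : ℤ)), Nat.sum_divisors_prime_pow hp]
  have hterm : ∀ k ∈ Finset.range (i + 1), bcoef (p ^ k) * ((p ^ i / p ^ k : ℕ) : ℤ) =
      (if k = 0 then 1 else 1 - (p : ℤ)) * (p : ℤ) ^ (i - k) := by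
    intro k hk
    rw [Nat.pow_div (Nat.lt_succ_iff.mp (Finset.mem_range.mp hk)) hp.pos]
    split_ifs with h0
    · simp [h0, bcoef_one]
    · simp [bcoef_prime_pow hp h0]
  rw [Finset.sum_congr rfl hterm]
  clear hterm
  induction i with
  | zero => simp
  | succ i ih =>
    rw [Finset.sum_range_succ]
    have hstep : ∀ k ∈ Finset.range (i + 1),
        (if k = 0 then 1 else 1 - (p : ℤ)) * (p : ℤ) ^ (i + 1 - k) =
        p * ((if k = 0 then 1 else 1 - (p : ℤ)) * (p : ℤ) ^ (i - k)) := by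
      intro k hk
      rw [Nat.succ_sub (Nat.lt_succ_iff.mp (Finset.mem_range.mp hk)), pow_succ]
      ring
    rw [Finset.sum_congr rfl hstep, ← Finset.mul_sum, ih]
    simp

/-- `bcoef` is the Dirichlet convolution of the constant `1` with the inverse of the identity. -/
lemma sum_divisorsAntidiagonal_bcoef_mul {j : ℕ} (hj : j ≠ 0) :
    ∑ x ∈ j.divisorsAntidiagonal, bcoef x.1 * (x.2 : ℤ) = 1 := by
  set f : ArithmeticFunction ℤ := ⟨fun m => if m = 0 then 0 else bcoef m, by simp⟩
  have hf : ∀ m : ℕ, m ≠ 0 → f m = bcoef m := fun m hm => if_neg hm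
  have hmul : f.IsMultiplicative := by
    refine ArithmeticFunction.IsMultiplicative.iff_ne_zero.mpr ⟨?_, fun {m n} hm hn h => ?_⟩
    · rw [hf 1 one_ne_zero, bcoef_one]
    · rw [hf _ (mul_ne_zero hm hn), hf _ hm, hf _ hn, bcoef_mul_of_coprime h]
  have hid : ((ArithmeticFunction.id : ArithmeticFunction ℕ) :
      ArithmeticFunction ℤ).IsMultiplicative := ArithmeticFunction.isMultiplicative_id.natCast
  have hz : ((ArithmeticFunction.zeta : ArithmeticFunction ℕ) :
      ArithmeticFunction ℤ).IsMultiplicative := ArithmeticFunction.isMultiplicative_zeta.natCast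
  have hconv : ∀ n : ℕ, (f * ((ArithmeticFunction.id : ArithmeticFunction ℕ) :
      ArithmeticFunction ℤ)) n = ∑ x ∈ n.divisorsAntidiagonal, bcoef x.1 * (x.2 : ℤ) := fun n => by
    rw [ArithmeticFunction.mul_apply]
    refine Finset.sum_congr rfl fun x hx => ?_
    rw [hf _ (Nat.ne_zero_of_mem_divisorsAntidiagonal hx).1]
    simp
  have key := (ArithmeticFunction.IsMultiplicative.eq_iff_eq_on_prime_powers _ (hmul.mul hid)
    _ hz).mpr fun p i hp => by
      rw [hconv, sum_divisorsAntidiagonal_prime_pow_bcoef_mul hp]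
      simp [hp.ne_zero]
  rw [← hconv, key]
  simp [hj]

/-- The Dirichlet coefficients `Λ(n) log n` of the derivative of `ζ'/ζ` on `Re s > 1`. -/
noncomputable def vonMangoldtLog : ℕ → ℂ :=
  LSeries.logMul fun n => (ArithmeticFunction.vonMangoldt n : ℂ)

/-- The Dirichlet coefficients `Λ(n) ^ 2`. -/
noncomputable def vonMangoldtSq (n : ℕ) : ℂ := (ArithmeticFunction.vonMangoldt n : ℂ) ^ 2

lemma abscissaOfAbsConv_vonMangoldt_lt {s : ℂ} (hs : 1 < s.re) :
    LSeries.abscissaOfAbsConv (fun n => (ArithmeticFunction.vonMangoldt n : ℂ)) < s.re := by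
  obtain ⟨x, hx1, hx⟩ := exists_between hs
  refine lt_of_le_of_lt (b := ((x : ℝ) : EReal)) ?_ (by exact_mod_cast hx)
  have := (ArithmeticFunction.LSeriesSummable_vonMangoldt (s := x)
    (by simpa using hx1)).abscissaOfAbsConv_le
  simpa using this

lemma LSeriesSummable_vonMangoldtLog {s : ℂ} (hs : 1 < s.re) : LSeriesSummable vonMangoldtLog s :=
  LSeriesSummable_logMul_of_lt_re (abscissaOfAbsConv_vonMangoldt_lt hs)

lemma zetaLogDerivDeriv_eq_LSeries {s : ℂ} (hs : 1 < s.re) :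
    zetaLogDerivDeriv s = LSeries vonMangoldtLog s := by
  have hev : (fun z => deriv riemannZeta z / riemannZeta z) =ᶠ[𝓝 s]
      fun z => -LSeries (fun n => (ArithmeticFunction.vonMangoldt n : ℂ)) z := by
    filter_upwards [(isOpen_lt continuous_const Complex.continuous_re).mem_nhds hs] with z hz
    rw [ArithmeticFunction.LSeries_vonMangoldt_eq_deriv_riemannZeta_div hz]
    ring
  rw [zetaLogDerivDeriv, hev.deriv_eq, deriv.fun_neg,
    LSeries_deriv (abscissaOfAbsConv_vonMangoldt_lt hs), neg_neg, vonMangoldtLog]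

lemma norm_term_vonMangoldtLog_le {z : ℂ} {m : ℕ} (hz : (m : ℝ) + 2 ≤ z.re) (n : ℕ) :
    ‖LSeries.term vonMangoldtLog z n‖ ≤ (1 / 2) ^ m * ‖LSeries.term vonMangoldtLog 2 n‖ := by
  rw [LSeries.norm_term_eq, LSeries.norm_term_eq]
  split_ifs with h0
  · simp
  rcases eq_or_ne n 1 with rfl | h1
  · simp [vonMangoldtLog, LSeries.logMul]
  have hn : (2 : ℝ) ≤ n := by exact_mod_cast (by omega : 2 ≤ n)
  have hn0 : (0 : ℝ) < n := by linarith
  have hpow : (2 : ℝ) ^ m * (n : ℝ) ^ (2 : ℂ).re ≤ (n : ℝ) ^ z.re := by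
    calc (2 : ℝ) ^ m * (n : ℝ) ^ (2 : ℂ).re ≤ (n : ℝ) ^ m * (n : ℝ) ^ (2 : ℂ).re := by gcongr
      _ = (n : ℝ) ^ ((m : ℝ) + 2) := by
        rw [Real.rpow_add hn0, Real.rpow_natCast]; simp
      _ ≤ (n : ℝ) ^ z.re := Real.rpow_le_rpow_of_exponent_le (by linarith) hz
  calc ‖vonMangoldtLog n‖ / (n : ℝ) ^ z.re
      ≤ ‖vonMangoldtLog n‖ / ((2 : ℝ) ^ m * (n : ℝ) ^ (2 : ℂ).re) := by gcongr
    _ = _ := by rw [one_div, inv_pow]; field_simp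

/-- The sum of the absolute values of the Dirichlet series at `2` with
coefficients `vonMangoldtLog`. -/
noncomputable def vonMangoldtLogBound : ℝ := ∑' n, ‖LSeries.term vonMangoldtLog 2 n‖

lemma summable_norm_term_vonMangoldtLog_two :
    Summable fun n => ‖LSeries.term vonMangoldtLog 2 n‖ :=
  (LSeriesSummable_vonMangoldtLog (by norm_num)).norm

lemma tsum_norm_term_vonMangoldtLog_le {z : ℂ} {m : ℕ} (hz : (m : ℝ) + 2 ≤ z.re) :
    ∑' n, ‖LSeries.term vonMangoldtLog z n‖ ≤ (1 / 2) ^ m * vonMangoldtLogBound := by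
  rw [vonMangoldtLogBound, ← tsum_mul_left]
  have hz1 : 1 < z.re := by linarith [(Nat.cast_nonneg m : (0 : ℝ) ≤ m)]
  exact (LSeriesSummable_vonMangoldtLog hz1).norm.tsum_le_tsum (norm_term_vonMangoldtLog_le hz)
    (summable_norm_term_vonMangoldtLog_two.mul_left _)

lemma vonMangoldtLogBound_nonneg : 0 ≤ vonMangoldtLogBound := tsum_nonneg fun _ => norm_nonneg _

lemma norm_bcoef_le {m : ℕ} (hm : m ≠ 0) : ‖(bcoef m : ℂ)‖ ≤ m := by
  rw [Complex.norm_intCast]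
  exact_mod_cast abs_bcoef_le hm

/-- The summable majorant of the terms with `m ≥ 2` in the series defining `Kcont`. -/
noncomputable def KcontBound (m : ℕ) : ℝ := (m + 2) * ((1 / 2) ^ m * vonMangoldtLogBound)

lemma summable_KcontBound : Summable KcontBound := by
  have h1 : Summable fun m : ℕ => (m : ℝ) * (1 / 2 : ℝ) ^ m := by
    simpa using summable_pow_mul_geometric_of_norm_lt_one 1 (r := (1 / 2 : ℝ)) (by norm_num)
  have h2 : Summable fun m : ℕ => (1 / 2 : ℝ) ^ m := summable_geometric_two
  refine ((h1.add (h2.mul_left 2)).mul_right vonMangoldtLogBound).congr fun m => ?_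
  simp only [KcontBound]
  ring

lemma add_two_le_re {s : ℂ} (hs : 1 ≤ s.re) (m : ℕ) :
    (m : ℝ) + 2 ≤ (((m + 1 + 1 : ℕ) : ℂ) * s).re := by
  have : (((m + 1 + 1 : ℕ) : ℂ) * s).re = ((m : ℝ) + 2) * s.re := by
    rw [← Complex.ofReal_natCast, Complex.re_ofReal_mul]; push_cast; ring
  rw [this]
  nlinarith [(Nat.cast_nonneg m : (0 : ℝ) ≤ m)]

lemma norm_bcoef_mul_tsum_le {s : ℂ} (hs : 1 ≤ s.re) (m : ℕ) :
    ‖(bcoef (m + 1 + 1) : ℂ)‖ *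
      ∑' n, ‖LSeries.term vonMangoldtLog (((m + 1 + 1 : ℕ) : ℂ) * s) n‖ ≤ KcontBound m := by
  have hb : ‖(bcoef (m + 1 + 1) : ℂ)‖ ≤ (m : ℝ) + 2 := by
    refine (norm_bcoef_le (by omega)).trans (le_of_eq ?_)
    push_cast; ring
  exact mul_le_mul hb (tsum_norm_term_vonMangoldtLog_le (add_two_le_re hs m))
    (tsum_nonneg fun _ => norm_nonneg _) (by positivity)

lemma norm_bcoef_mul_zetaLogDerivDeriv_le {s : ℂ} (hs : 1 ≤ s.re) (m : ℕ) :
    ‖(bcoef (m + 1 + 1) : ℂ) * zetaLogDerivDeriv (((m + 1 + 1 : ℕ) : ℂ) * s)‖ ≤ KcontBound m := by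
  have hre := add_two_le_re hs m
  have h1 : 1 < (((m + 1 + 1 : ℕ) : ℂ) * s).re := by linarith [(Nat.cast_nonneg m : (0 : ℝ) ≤ m)]
  rw [norm_mul]
  refine le_trans ?_ (norm_bcoef_mul_tsum_le hs m)
  gcongr
  rw [zetaLogDerivDeriv_eq_LSeries h1]
  exact norm_tsum_le_tsum_norm (LSeriesSummable_vonMangoldtLog h1).norm

lemma Kcont_eq {s : ℂ} (hs : 1 ≤ s.re) :
    Kcont s = zetaLogDerivDeriv s +
      ∑' m : ℕ, (bcoef (m + 1 + 1) : ℂ) * zetaLogDerivDeriv (((m + 1 + 1 : ℕ) : ℂ) * s) := by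
  have hsum : Summable fun m : ℕ =>
      (bcoef (m + 1) : ℂ) * zetaLogDerivDeriv (((m + 1 : ℕ) : ℂ) * s) := by
    rw [← summable_nat_add_iff 1]
    exact Summable.of_norm_bounded summable_KcontBound (norm_bcoef_mul_zetaLogDerivDeriv_le hs)
  rw [Kcont, hsum.tsum_eq_zero_add]
  simp [bcoef_one]

lemma tendsto_Kcont {α : Type*} {l : Filter α} {u : α → ℂ} {s : ℂ} (hu : Tendsto u l (𝓝 s))
    (hu1 : ∀ a, 1 ≤ (u a).re) (hs : 1 ≤ s.re) (hs1 : s ≠ 1) :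
    Tendsto (fun a => Kcont (u a)) l (𝓝 (Kcont s)) := by
  rw [Kcont_eq hs]
  simp only [fun a => Kcont_eq (hu1 a)]
  refine ((continuousAt_zetaLogDerivDeriv hs hs1).tendsto.comp hu).add ?_
  refine tendsto_tsum_of_dominated_convergence summable_KcontBound (fun m => ?_)
    (Eventually.of_forall fun a m => norm_bcoef_mul_zetaLogDerivDeriv_le (hu1 a) m)
  refine Tendsto.const_mul _ ?_
  have hre := add_two_le_re hs m
  have h1 : 1 < (((m + 1 + 1 : ℕ) : ℂ) * s).re := by linarith [(Nat.cast_nonneg m : (0 : ℝ) ≤ m)]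
  exact (continuousAt_zetaLogDerivDeriv h1.le (by rintro h; rw [h] at h1; simp at h1)).tendsto.comp
    (hu.const_mul _)

lemma exists_norm_Kcont_le {δ : ℝ} (hδ : 0 < δ) :
    ∃ C : ℝ, 0 < C ∧ ∀ σ t : ℝ, 1 ≤ σ → σ ≤ 2 → δ ≤ |t| → ‖Kcont (σ + t * I)‖ ≤ C * |t| := by
  obtain ⟨C, hC0, hC⟩ := exists_norm_zetaLogDerivDeriv_le hδ
  set D : ℝ := ∑' m, KcontBound m
  have hD : 0 ≤ D := tsum_nonneg fun m => by
    rw [KcontBound]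
    have := vonMangoldtLogBound_nonneg
    positivity
  refine ⟨C + D / δ, by positivity, fun σ t h1 h2 ht => ?_⟩
  have hre : 1 ≤ (σ + t * I : ℂ).re := by simpa using h1
  rw [Kcont_eq hre]
  calc _ ≤ C * |t| + D := (norm_add_le _ _).trans (add_le_add (hC σ t h1 h2 ht)
        (tsum_of_norm_bounded summable_KcontBound.hasSum (norm_bcoef_mul_zetaLogDerivDeriv_le hre)))
    _ = C * |t| + D / δ * δ := by field_simp
    _ ≤ C * |t| + D / δ * |t| := by gcongr
    _ = _ := by ring

lemma summable_bcoef_mul_term {s : ℂ} (hs : 1 < s.re) :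
    Summable fun x : ℕ × ℕ =>
      (bcoef (x.1 + 1) : ℂ) * LSeries.term vonMangoldtLog (((x.1 + 1 : ℕ) : ℂ) * s) x.2 := by
  have hre : ∀ m : ℕ, 1 < (((m + 1 : ℕ) : ℂ) * s).re := fun m => by
    rw [← Complex.ofReal_natCast, Complex.re_ofReal_mul]
    push_cast
    nlinarith [(Nat.cast_nonneg m : (0 : ℝ) ≤ m)]
  refine Summable.of_norm ((summable_prod_of_nonneg fun _ => norm_nonneg _).mpr ⟨fun m => ?_, ?_⟩)
  · simp only [norm_mul]
    exact (LSeriesSummable_vonMangoldtLog (hre m)).norm.mul_left _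
  · simp only [norm_mul, tsum_mul_left]
    rw [← summable_nat_add_iff 1]
    refine Summable.of_nonneg_of_le (fun m => ?_) (norm_bcoef_mul_tsum_le hs.le) summable_KcontBound
    exact mul_nonneg (norm_nonneg _) (tsum_nonneg fun _ => norm_nonneg _)

lemma vonMangoldtLog_eq_zero {n : ℕ} (hn : ¬IsPrimePow n) : vonMangoldtLog n = 0 := by
  simp [vonMangoldtLog, LSeries.logMul, ArithmeticFunction.vonMangoldt_eq_zero_iff.mpr hn]

lemma vonMangoldtLog_prime_pow {p : ℕ} (hp : p.Prime) {k : ℕ} (hk : k ≠ 0) :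
    vonMangoldtLog (p ^ k) = k * (Real.log p : ℂ) ^ 2 := by
  rw [vonMangoldtLog, LSeries.logMul, ArithmeticFunction.vonMangoldt_apply_pow hk,
    ArithmeticFunction.vonMangoldt_apply_prime hp, Complex.natCast_log.symm, Nat.cast_pow,
    Real.log_pow]
  push_cast
  ring

lemma term_vonMangoldtLog_natCast_mul (n m : ℕ) (s : ℂ) :
    LSeries.term vonMangoldtLog (((m + 1 : ℕ) : ℂ) * s) n =
      LSeries.term (fun _ => vonMangoldtLog n) s (n ^ (m + 1)) := by
  rcases eq_or_ne n 0 with rfl | hn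
  · simp
  rw [LSeries.term_of_ne_zero hn, LSeries.term_of_ne_zero (pow_ne_zero _ hn), Nat.cast_pow,
    ← Complex.natCast_cpow_natCast_mul]

lemma tsum_fiber_eq_term_vonMangoldtSq (s : ℂ) (N : ℕ) :
    ∑' x : (fun x : ℕ × ℕ => x.2 ^ (x.1 + 1)) ⁻¹' {N}, (bcoef (x.1.1 + 1) : ℂ) *
        LSeries.term vonMangoldtLog (((x.1.1 + 1 : ℕ) : ℂ) * s) x.1.2 =
      LSeries.term vonMangoldtSq s N := by
  by_cases hN : IsPrimePow N
  · obtain ⟨p, j, hp, hj, rfl⟩ := hN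
    have hp' : p.Prime := hp.nat_prime
    set G : ℕ × ℕ → ℂ := fun x => (bcoef (x.1 + 1) : ℂ) *
        LSeries.term vonMangoldtLog (((x.1 + 1 : ℕ) : ℂ) * s) x.2 with hG
    rw [tsum_subtype ((fun x : ℕ × ℕ => x.2 ^ (x.1 + 1)) ⁻¹' {p ^ j}) G,
      tsum_eq_sum (s := j.divisorsAntidiagonal.image fun x : ℕ × ℕ => (x.1 - 1, p ^ x.2)),
      Finset.sum_image]
    · have hval : ∀ x ∈ j.divisorsAntidiagonal,
          ((fun x : ℕ × ℕ => x.2 ^ (x.1 + 1)) ⁻¹' {p ^ j}).indicator G (x.1 - 1, p ^ x.2) =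
          ((bcoef x.1 * (x.2 : ℤ) : ℤ) : ℂ) * LSeries.term vonMangoldtSq s (p ^ j) := by
        rintro ⟨a, b⟩ hx
        obtain ⟨ha, hb⟩ := Nat.ne_zero_of_mem_divisorsAntidiagonal hx
        have hab : a * b = j := (Nat.mem_divisorsAntidiagonal.mp hx).1
        dsimp only at ha hb ⊢
        have ha1 : a - 1 + 1 = a := by omega
        have hpow : (p ^ b) ^ (a - 1 + 1) = p ^ j := by rw [ha1, ← pow_mul, mul_comm, hab]
        rw [Set.indicator_of_mem (by simpa using hpow), hG]
        dsimp only
        rw [term_vonMangoldtLog_natCast_mul, hpow, ha1,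
          LSeries.term_of_ne_zero (pow_ne_zero _ hp'.ne_zero),
          LSeries.term_of_ne_zero (pow_ne_zero _ hp'.ne_zero), vonMangoldtLog_prime_pow hp' hb,
          vonMangoldtSq, ArithmeticFunction.vonMangoldt_apply_pow hj.ne',
          ArithmeticFunction.vonMangoldt_apply_prime hp']
        push_cast
        ring
      rw [Finset.sum_congr rfl hval, ← Finset.sum_mul, ← Int.cast_sum,
        sum_divisorsAntidiagonal_bcoef_mul hj.ne', Int.cast_one, one_mul]
    · rintro ⟨a, b⟩ hx ⟨a', b'⟩ hx' h
      have h1 := (Nat.ne_zero_of_mem_divisorsAntidiagonal hx).1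
      have h2 := (Nat.ne_zero_of_mem_divisorsAntidiagonal hx').1
      simp only [Prod.mk.injEq] at h h1 h2 ⊢
      exact ⟨by omega, Nat.pow_right_injective hp'.two_le h.2⟩
    · rintro ⟨m, n⟩ hx
      refine Set.indicator_of_notMem (fun hmem => hx ?_) _
      have hmem' : n ^ (m + 1) = p ^ j := hmem
      obtain ⟨b, -, rfl⟩ := (Nat.dvd_prime_pow hp').mp
        (hmem' ▸ dvd_pow_self n (Nat.succ_ne_zero m))
      rw [← pow_mul] at hmem'
      have hbj := Nat.pow_right_injective hp'.two_le hmem'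
      refine Finset.mem_image.mpr ⟨(m + 1, b), ?_, by simp⟩
      exact Nat.mem_divisorsAntidiagonal.mpr ⟨by rw [mul_comm]; exact hbj, hj.ne'⟩
  · have hsq : vonMangoldtSq N = 0 := by
      simp [vonMangoldtSq, ArithmeticFunction.vonMangoldt_eq_zero_iff.mpr hN]
    have hR : LSeries.term vonMangoldtSq s N = 0 := by
      rw [LSeries.term]; simp [hsq]
    rw [hR]
    refine (tsum_congr fun x => ?_).trans tsum_zero
    have hx : x.1.2 ^ (x.1.1 + 1) = N := x.2
    have : ¬IsPrimePow x.1.2 := fun h => hN (hx ▸ h.pow (Nat.succ_ne_zero _))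
    rw [LSeries.term]
    simp [vonMangoldtLog_eq_zero this]

lemma hasSum_term_vonMangoldtSq {s : ℂ} (hs : 1 < s.re) :
    HasSum (LSeries.term vonMangoldtSq s) (Kcont s) := by
  have hre : ∀ m : ℕ, 1 < (((m + 1 : ℕ) : ℂ) * s).re := fun m => by
    rw [← Complex.ofReal_natCast, Complex.re_ofReal_mul]
    push_cast
    nlinarith [(Nat.cast_nonneg m : (0 : ℝ) ≤ m)]
  have hsum := summable_bcoef_mul_term hs
  have hK : Kcont s = ∑' x : ℕ × ℕ,
      (bcoef (x.1 + 1) : ℂ) * LSeries.term vonMangoldtLog (((x.1 + 1 : ℕ) : ℂ) * s) x.2 := by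
    rw [hsum.tsum_prod, Kcont]
    refine tsum_congr fun m => ?_
    rw [zetaLogDerivDeriv_eq_LSeries (hre m), LSeries, ← tsum_mul_left]
  have hfib := hsum.hasSum.tsum_fiberwise (fun x : ℕ × ℕ => x.2 ^ (x.1 + 1))
  rw [← hK] at hfib
  rwa [funext fun N => tsum_fiber_eq_term_vonMangoldtSq s N] at hfib

lemma term_vonMangoldtSq_add_mul_I (σ t : ℝ) (n : ℕ) :
    LSeries.term vonMangoldtSq (σ + t * I) n = LSeries.term vonMangoldtSq σ n *
      Complex.exp (-(2 * Real.pi * I * t * ((Real.log n / (2 * Real.pi) : ℝ) : ℂ))) := by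
  rcases eq_or_ne n 0 with rfl | hn
  · simp
  have hn' : (n : ℂ) ≠ 0 := by exact_mod_cast hn
  rw [LSeries.term_of_ne_zero hn, LSeries.term_of_ne_zero hn, Complex.cpow_add _ _ hn',
    Complex.cpow_def_of_ne_zero hn' (t * I), ← div_div, div_eq_mul_inv _ (Complex.exp _),
    ← Complex.exp_neg, ← Complex.natCast_log]
  congr 2
  have : (Real.pi : ℂ) ≠ 0 := by exact_mod_cast Real.pi_ne_zero
  push_cast
  field_simp

lemma norm_exp_neg_two_pi_I_mul (t ξ : ℝ) :
    ‖Complex.exp (-(2 * Real.pi * I * t * ξ))‖ = 1 := by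
  rw [show -(2 * Real.pi * I * t * ξ) = ((-(2 * Real.pi * t * ξ) : ℝ) : ℂ) * I by push_cast; ring,
    Complex.norm_exp_ofReal_mul_I]

lemma integrable_mul_exp {h : ℝ → ℂ} (hh : Integrable h) (ξ : ℝ) :
    Integrable fun t : ℝ => h t * Complex.exp (-(2 * Real.pi * I * t * ξ)) := by
  refine hh.mul_bdd (c := 1) (Continuous.aestronglyMeasurable (by fun_prop))
    (Eventually.of_forall fun t => (norm_exp_neg_two_pi_I_mul t ξ).le)

lemma tsum_term_mul_FT {h : ℝ → ℂ} (hh : Integrable h) {σ : ℝ} (hσ : 1 < σ) :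
    ∑' n : ℕ, LSeries.term vonMangoldtSq σ n * FT h (Real.log n / (2 * Real.pi)) =
      ∫ t : ℝ, h t * Kcont (σ + t * I) := by
  have hre : ∀ t : ℝ, 1 < (σ + t * I : ℂ).re := fun t => by simpa using hσ
  have hsum : Summable fun n => ‖LSeries.term vonMangoldtSq σ n‖ :=
    (hasSum_term_vonMangoldtSq (s := σ) (by simpa using hσ)).summable.norm
  set F : ℕ → ℝ → ℂ := fun n t => LSeries.term vonMangoldtSq σ n *
    (h t * Complex.exp (-(2 * Real.pi * I * t * ((Real.log n / (2 * Real.pi) : ℝ) : ℂ)))) with hF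
  have hint : ∀ n, Integrable (F n) := fun n => (integrable_mul_exp hh _).const_mul _
  have hnorm : ∀ n, ∫ t, ‖F n t‖ = ‖LSeries.term vonMangoldtSq σ n‖ * ∫ t, ‖h t‖ := fun n => by
    simp only [hF, norm_mul, norm_exp_neg_two_pi_I_mul, mul_one]
    exact integral_const_mul _ _
  have key := hasSum_integral_of_summable_integral_norm hint (by
    simp only [hnorm]; exact hsum.mul_right _)
  have hval : ∀ n, ∫ t, F n t = LSeries.term vonMangoldtSq σ n *
      FT h (Real.log n / (2 * Real.pi)) := fun n => integral_const_mul _ _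
  rw [← tsum_congr hval, key.tsum_eq]
  congr 1
  funext t
  rw [← (hasSum_term_vonMangoldtSq (hre t)).tsum_eq, ← tsum_mul_left]
  refine tsum_congr fun n => ?_
  rw [term_vonMangoldtSq_add_mul_I, hF]
  ring

lemma MemH0.exists_eq_zero {h : ℝ → ℂ} (hh : MemH0 h) :
    ∃ δ > 0, ∀ t, |t| < δ → h t = 0 := by
  have := isClosed_closure.isOpen_compl.mem_nhds hh.zero_not_mem
  obtain ⟨δ, hδ, hsub⟩ := Metric.mem_nhds_iff.mp this
  refine ⟨δ, hδ, fun t ht => ?_⟩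
  by_contra hne
  exact hsub (by simpa using ht) (subset_closure hne)

lemma MemH0.exists_norm_mul_Kcont_le {h : ℝ → ℂ} (hh : MemH0 h) :
    ∃ C : ℝ, ∀ σ t : ℝ, 1 ≤ σ → σ ≤ 2 →
      ‖h t * Kcont (σ + t * I)‖ ≤ C * ‖(t : ℂ) * h t‖ := by
  obtain ⟨δ, hδ, h0⟩ := hh.exists_eq_zero
  obtain ⟨C, -, hC⟩ := exists_norm_Kcont_le hδ
  refine ⟨C, fun σ t h1 h2 => ?_⟩
  rcases lt_or_ge |t| δ with ht | ht
  · simp [h0 t ht]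
  · rw [norm_mul, norm_mul, Complex.norm_real, Real.norm_eq_abs]
    calc ‖h t‖ * ‖Kcont (σ + t * I)‖ ≤ ‖h t‖ * (C * |t|) := by gcongr; exact hC σ t h1 h2 ht
      _ = _ := by ring

lemma aestronglyMeasurable_mul_Kcont {h : ℝ → ℂ} (hh : Integrable h) {σ : ℝ} (hσ : 1 < σ) :
    AEStronglyMeasurable fun t : ℝ => h t * Kcont (σ + t * I) := by
  have hcont : Continuous fun t : ℝ => Kcont (σ + t * I) := by
    refine continuous_iff_continuousAt.mpr fun t => ?_
    have hu : Tendsto (fun x : ℝ => (σ + x * I : ℂ)) (𝓝 t) (𝓝 (σ + t * I)) :=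
      Continuous.tendsto (by fun_prop) t
    refine tendsto_Kcont hu (fun a => by simpa using hσ.le) (by simpa using hσ.le) fun h1 => ?_
    have := congrArg Complex.re h1
    simp at this
    linarith
  exact hh.aestronglyMeasurable.mul hcont.aestronglyMeasurable

lemma MemH0.tendsto_mul_Kcont {h : ℝ → ℂ} (hh : MemH0 h) {σ : ℕ → ℝ}
    (hσ : Tendsto σ atTop (𝓝 1)) (hσ1 : ∀ k, 1 < σ k) (t : ℝ) :
    Tendsto (fun k => h t * Kcont (σ k + t * I)) atTop (𝓝 (h t * Kcont (1 + t * I))) := by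
  rcases eq_or_ne t 0 with rfl | ht
  · obtain ⟨δ, hδ, h0⟩ := hh.exists_eq_zero
    simp [h0 0 (by simpa using hδ)]
  refine (tendsto_Kcont ?_ (fun k => by simpa using (hσ1 k).le) (by simp) ?_).const_mul _
  · have : Tendsto (fun k => ((σ k : ℝ) : ℂ)) atTop (𝓝 ((1 : ℝ) : ℂ)) :=
      (Complex.continuous_ofReal.tendsto 1).comp hσ
    simpa using this.add_const (t * I)
  · intro h1
    have := congrArg Complex.im h1
    simp [ht] at this

lemma MemH0.integrable_mul_Kcont {h : ℝ → ℂ} (hh : MemH0 h) {σ : ℕ → ℝ}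
    (hσ : Tendsto σ atTop (𝓝 1)) (hσ1 : ∀ k, 1 < σ k) :
    Integrable fun t : ℝ => h t * Kcont (1 + t * I) := by
  obtain ⟨C, hC⟩ := hh.exists_norm_mul_Kcont_le
  refine Integrable.mono' (hh.xh_integrable.norm.const_mul C)
    (aestronglyMeasurable_of_tendsto_ae atTop
      (fun k => aestronglyMeasurable_mul_Kcont hh.integrable (hσ1 k))
      (Eventually.of_forall fun t => hh.tendsto_mul_Kcont hσ hσ1 t))
    (Eventually.of_forall fun t => ?_)
  simpa using hC 1 t le_rfl one_le_two

lemma MemH0.tendsto_integral_mul_Kcont {h : ℝ → ℂ} (hh : MemH0 h) {σ : ℕ → ℝ}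
    (hσ : Tendsto σ atTop (𝓝 1)) (hσ1 : ∀ k, 1 < σ k) (hσ2 : ∀ k, σ k ≤ 2) :
    Tendsto (fun k => ∫ t : ℝ, h t * Kcont (σ k + t * I)) atTop
      (𝓝 (∫ t : ℝ, h t * Kcont (1 + t * I))) := by
  obtain ⟨C, hC⟩ := hh.exists_norm_mul_Kcont_le
  exact tendsto_integral_of_dominated_convergence _
    (fun k => aestronglyMeasurable_mul_Kcont hh.integrable (hσ1 k))
    (hh.xh_integrable.norm.const_mul C)
    (fun k => Eventually.of_forall fun t => hC _ t (hσ1 k).le (hσ2 k))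
    (Eventually.of_forall fun t => hh.tendsto_mul_Kcont hσ hσ1 t)

lemma MemH.tendsto_tsum_term_mul_FT {h : ℝ → ℂ} (hh : MemH h) {σ : ℕ → ℝ}
    (hσ : Tendsto σ atTop (𝓝 1)) (hσ1 : ∀ k, 1 < σ k) :
    Tendsto (fun k => ∑' n : ℕ, LSeries.term vonMangoldtSq (σ k) n *
        FT h (Real.log n / (2 * Real.pi))) atTop
      (𝓝 (∑' n : ℕ, ((ArithmeticFunction.vonMangoldt n : ℂ) ^ 2 / (n : ℂ)) *
        FT h (Real.log n / (2 * Real.pi)))) := by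
  refine tendsto_tsum_of_dominated_convergence hh.summable_norm_vonMangoldt_FT (fun n => ?_)
    (Eventually.of_forall fun k n => ?_)
  · refine Tendsto.mul_const _ ?_
    rcases eq_or_ne n 0 with rfl | hn
    · simp
    have hn' : (n : ℂ) ≠ 0 := by exact_mod_cast hn
    simp only [LSeries.term_of_ne_zero hn, vonMangoldtSq]
    refine tendsto_const_nhds.div ?_ hn'
    have h1 : Tendsto (fun k => ((σ k : ℝ) : ℂ)) atTop (𝓝 ((1 : ℝ) : ℂ)) :=
      (Complex.continuous_ofReal.tendsto 1).comp hσ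
    simpa using h1.const_cpow (Or.inl hn')
  · rcases eq_or_ne n 0 with rfl | hn
    · simp
    have hn1 : (1 : ℝ) ≤ n := by exact_mod_cast Nat.one_le_iff_ne_zero.mpr hn
    rw [norm_mul, norm_mul, LSeries.norm_term_eq, if_neg hn, norm_div, Complex.norm_natCast,
      vonMangoldtSq]
    gcongr
    simpa using Real.rpow_le_rpow_of_exponent_le hn1 (hσ1 k).le

/-- For `h ∈ H₀`, `∑_{n≥1} (Λ(n)²/n) ĥ(log n / 2π) = ∫ h(t) K(1+it) dt`,
with both the series and the integral converging absolutely. -/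
theorem vonMangoldt_FT_sum_eq_integral (h : ℝ → ℂ) (hh : MemH0 h) :
    Summable (fun n : ℕ =>
      ‖((ArithmeticFunction.vonMangoldt n : ℂ) ^ 2 / (n : ℂ)) *
          FT h (Real.log n / (2 * Real.pi))‖) ∧
    Integrable (fun t : ℝ => h t * Kcont (1 + t * Complex.I)) ∧
    ∑' n : ℕ, ((ArithmeticFunction.vonMangoldt n : ℂ) ^ 2 / (n : ℂ)) *
        FT h (Real.log n / (2 * Real.pi)) =
      ∫ t : ℝ, h t * Kcont (1 + t * Complex.I) := by
  set σ : ℕ → ℝ := fun k => 1 + 1 / ((k : ℝ) + 1)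
  have hσ : Tendsto σ atTop (𝓝 1) := by
    simpa [σ] using tendsto_one_div_add_atTop_nhds_zero_nat.const_add (1 : ℝ)
  have hσ1 : ∀ k, 1 < σ k := fun k => lt_add_of_pos_right _ Nat.one_div_pos_of_nat
  have hσ2 : ∀ k, σ k ≤ 2 := fun k => by
    have : 1 / ((k : ℝ) + 1) ≤ 1 := div_le_one_of_le₀ (by simp) (by positivity)
    simp only [σ]
    linarith
  refine ⟨hh.toMemH.summable_norm_vonMangoldt_FT, hh.integrable_mul_Kcont hσ hσ1,
    tendsto_nhds_unique (hh.toMemH.tendsto_tsum_term_mul_FT hσ hσ1) ?_⟩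
  simp only [fun k => tsum_term_mul_FT hh.integrable (hσ1 k)]
  exact hh.tendsto_integral_mul_Kcont hσ hσ1 hσ2
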